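/- (Lemma, adding a goal) Let G be a goal, W a multiset of atoms, and δ ∈ S'_P(G) such that Fv(W) ∩ V_loc(δ) = ∅. Then δ ⊕ W ∈ S'_P(G,W), where δ ⊕ W is the sequence obtained from δ by adding W to every goal component of every tuple. -/

import Mathlib

/-!
A formalization of the syntax and (compositional) semantics of
Constraint Handling Rules (CHR), following Gabbrielli & Meo,
"A compositional trace semantics for CHR".
-/

noncomputable section

namespace CHR

attribute [local instance] Classical.propDecidable

/-- An abstract CHR language: variables, built-in constraints with a
first-order theory `CT` (given through the entailment relation `entails`),
and user-defined (CHR) atomic constraints. -/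
structure Lang : Type 1 where
  /-- variables -/
  V : Type
  /-- built-in constraints -/
  B : Type
  /-- user-defined (CHR) atomic constraints -/
  U : Type
  fvB : B → Set V
  fvU : U → Set V
  /-- the empty (true) built-in constraint -/
  tt : B
  /-- the inconsistent built-in constraint `false` -/
  ff : B
  /-- conjunction of built-in constraints -/
  and : B → B → B
  /-- the parameter-passing equation `H = H'` between multisets of user atoms -/
  eqC : Multiset U → Multiset U → B
  /-- existential quantification `∃_x` over a set of variables -/
  exQ : Set V → B → B
  /-- existential closure `∃_{-V}` except for the variables in the given set -/
  exNot : Set V → B → B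
  /-- `CT ⊨ b → b'` -/
  entails : B → B → Prop
  entails_refl : ∀ b, entails b b
  entails_trans : ∀ {a b c}, entails a b → entails b c → entails a c
  entails_tt : ∀ b, entails b tt
  ff_entails : ∀ b, entails ff b
  tt_not_ff : ¬ entails tt ff
  and_left : ∀ a b, entails (and a b) a
  and_right : ∀ a b, entails (and a b) b
  and_intro : ∀ {a b c}, entails a b → entails a c → entails a (and b c)
  entails_exQ : ∀ (x : Set V) b, entails b (exQ x b)
  eqC_refl : ∀ M, entails tt (eqC M M)
  /-- `eqAtom c a b` means `CT ⊨ c ∧ b ↔ c ∧ a`, for user-defined atoms `a`, `b` -/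
  eqAtom : B → U → U → Prop
  eqAtom_refl : ∀ c a, eqAtom c a a

variable (L : Lang)

/-- `CT ⊨ b ↔ b'` -/
def Lang.eqv (b b' : L.B) : Prop := L.entails b b' ∧ L.entails b' b

/-- a (built-in or user-defined) constraint -/
abbrev Constr := L.B ⊕ L.U
/-- a goal: a multiset of constraints -/
abbrev Goal := Multiset (Constr L)
/-- an indexed atom -/
abbrev IAtom := Constr L × ℕ
/-- a goal of indexed atoms -/
abbrev IGoal := Multiset (IAtom L)

def fvC : Constr L → Set L.V
  | Sum.inl b => L.fvB b
  | Sum.inr u => L.fvU u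

/-- free variables of a (plain) goal -/
def fvGoal0 (G : Goal L) : Set L.V := {v | ∃ a ∈ G, v ∈ fvC L a}
/-- free variables of an indexed goal -/
def fvGoal (g : IGoal L) : Set L.V := {v | ∃ a ∈ g, v ∈ fvC L a.1}
/-- free variables of a multiset of user-defined atoms -/
def fvUs (M : Multiset L.U) : Set L.V := {v | ∃ a ∈ M, v ∈ L.fvU a}

/-- a goal, with all its atoms indexed by `0` -/
def index0 (G : Goal L) : IGoal L := G.map (fun a => (a, 0))

/-- the maximal index occurring in an indexed goal -/
def maxIdx (g : IGoal L) : ℕ := ((g.map Prod.snd).toList).foldr max 0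

/-- a CHR simplification rule `H ⇔ C | B` -/
structure Rule (L : Lang) where
  head : Multiset L.U
  guard : L.B
  body : Multiset (Constr L)

/-- a CHR program: a finite set of simplification rules -/
def Program (L : Lang) := {S : Set (Rule L) // S.Finite}

/-- embedding of a multiset of indexed user atoms into an indexed goal -/
def embU (G0 : Multiset (L.U × ℕ)) : IGoal L := G0.map (fun p => (Sum.inr p.1, p.2))

/-! ### The compositional transition system -/

/-- the rule **Solve'** -/
def SolveStep (g : IGoal L) (c : L.B) (K : Multiset L.U) (g' : IGoal L) (d : L.B) : Prop :=
  K = 0 ∧ ∃ (cb : L.B) (i : ℕ) (G : IGoal L),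
    g = (Sum.inl cb, i) ::ₘ G ∧ g' = G ∧ L.eqv (L.and cb c) d ∧
    L.fvB d ⊆ L.fvB cb ∪ L.fvB c

/-- the rule **Simplify'**, applied to the (nonempty) sub-multiset `G0` of
user-defined atoms of the goal, with assumptions `K`. -/
def SimpStep (P : Program L) (G0 : Multiset (L.U × ℕ)) (g : IGoal L) (c : L.B)
    (K : Multiset L.U) (g' : IGoal L) (d : L.B) : Prop :=
  ∃ r ∈ P.1, ∃ A : IGoal L,
    G0 ≠ 0 ∧
    g = embU L G0 + A ∧
    r.head.card = G0.card + K.card ∧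
    L.entails c (L.exQ (fvUs L r.head) (L.and (L.eqC r.head (G0.map Prod.fst + K)) r.guard)) ∧
    g' = r.body.map (fun a => (a, maxIdx L g + 1)) + A ∧
    d = L.and (L.eqC r.head (G0.map Prod.fst + K)) c

/-- the labeled transition relation `⟨g,c⟩ →_P^K ⟨g',d⟩` -/
def Step (P : Program L) (g : IGoal L) (c : L.B) (K : Multiset L.U) (g' : IGoal L)
    (d : L.B) : Prop :=
  SolveStep L g c K g' d ∨ ∃ G0, SimpStep L P G0 g c K g' d

/-! ### Concrete sequences -/

/-- a tuple `⟨G,c,K,G',d⟩` of a concrete sequence -/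
structure Tup (L : Lang) where
  g : IGoal L
  c : L.B
  k : Multiset L.U
  g' : IGoal L
  d : L.B

/-- `Seq`: concrete sequences of derivation steps, terminated by a tuple
`⟨G,c,∅,G,c⟩`, with `CT ⊨ c_{i+1} → d_i` between adjacent tuples. -/
inductive IsSeq (P : Program L) : List (Tup L) → Prop
  | last (g : IGoal L) (c : L.B) : IsSeq P [⟨g, c, 0, g, c⟩]
  | step (t t' : Tup L) (rest : List (Tup L))
      (hstep : Step L P t.g t.c t.k t.g' t.d)
      (hlink : t'.g = t.g')
      (hmono : L.entails t'.c t.d)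
      (htail : IsSeq P (t' :: rest)) : IsSeq P (t :: t' :: rest)

/-- `V_loc` of a single tuple -/
def VlocT (t : Tup L) : Set L.V :=
  (fvGoal L t.g' ∪ L.fvB t.d) \ (fvGoal L t.g ∪ L.fvB t.c ∪ fvUs L t.k)

/-- all free variables of a tuple -/
def fvTup (t : Tup L) : Set L.V :=
  fvGoal L t.g ∪ L.fvB t.c ∪ fvUs L t.k ∪ fvGoal L t.g' ∪ L.fvB t.d

/-- `V_ass` of a concrete sequence -/
def VassC (δ : List (Tup L)) : Set L.V := {v | ∃ t ∈ δ, v ∈ fvUs L t.k}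
/-- `V_stable` of a concrete sequence -/
def VstableC (δ : List (Tup L)) : Set L.V :=
  {v | ∃ t, δ.getLast? = some t ∧ v ∈ fvGoal L t.g}
/-- `V_constr` of a concrete sequence -/
def VconstrC (δ : List (Tup L)) : Set L.V := {v | ∃ t ∈ δ, v ∈ L.fvB t.d \ L.fvB t.c}
/-- `V_loc` of a concrete sequence -/
def VlocC (δ : List (Tup L)) : Set L.V := {v | ∃ t ∈ δ, v ∈ VlocT L t}

/-- the set of input constraints of a concrete sequence -/
def IncC (δ : List (Tup L)) : Set L.B := {b | ∃ t ∈ δ, t.c = b}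
/-- the set of assumption atoms of a concrete sequence -/
def AssC (δ : List (Tup L)) : Set L.U := {a | ∃ t ∈ δ, a ∈ t.k}
/-- the set of (user-defined) atoms of the last goal of a concrete sequence -/
def StableC (δ : List (Tup L)) : Set L.U :=
  {a | ∃ t, δ.getLast? = some t ∧ ∃ i : ℕ, (Sum.inr a, i) ∈ t.g}

/-- compatibility of a tuple with a sequence of derivation steps -/
def Compatible (t : Tup L) (δ : List (Tup L)) : Prop :=
  (∀ t₂ ∈ δ.head?, L.entails t₂.c t.d) ∧
  VlocC L δ ∩ fvTup L t = ∅ ∧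
  VlocT L t ∩ VassC L δ = ∅ ∧
  ∀ i (h : i < δ.length),
    VlocT L t ∩ L.fvB (δ.get ⟨i, h⟩).c ⊆
      (L.fvB t.d ∪ {v | ∃ t' ∈ δ.take i, v ∈ L.fvB t'.d}) ∪ VstableC L δ

/-- `S'_P`, the least fixpoint of `Φ` (as an inductive definition):
`SP' P g δ` means `δ ∈ S'_P(g)`. -/
inductive SP' (P : Program L) : IGoal L → List (Tup L) → Prop
  | base (g : IGoal L) (c : L.B) : SP' P g [⟨g, c, 0, g, c⟩]
  | step (t : Tup L) (δ : List (Tup L))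
      (hcons : ¬ L.eqv t.c L.ff)
      (hstep : Step L P t.g t.c t.k t.g' t.d)
      (htail : SP' P t.g' δ)
      (hcompat : Compatible L t δ)
      (hseq : IsSeq L P (t :: δ)) :
      SP' P t.g (t :: δ)

/-! ### Abstract sequences -/

/-- a tuple `⟨c,K,H,d⟩` of an abstract sequence -/
structure ATup (L : Lang) where
  c : L.B
  k : Multiset L.U
  h : Multiset L.U
  d : L.B

/-- membership in the abstract semantic domain `D` -/
inductive InD : List (ATup L) → Prop
  | last (c : L.B) (h : Multiset L.U) : InD [⟨c, 0, h, c⟩]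
  | cons (t t' : ATup L) (rest : List (ATup L))
      (hdc : L.entails t.d t.c)
      (hsub : t.h ≤ t'.h)
      (hmono : L.entails t'.c t.d)
      (htail : InD (t' :: rest)) : InD (t :: t' :: rest)

/-- the multiset of (user-defined, de-indexed) atoms of `g` which are stable in `δ` -/
def stableH (δ : List (Tup L)) (g : IGoal L) : Multiset L.U :=
  g.filterMap (fun a =>
    match a.1 with
    | Sum.inl _ => none
    | Sum.inr u => if (∀ t ∈ δ, a ∈ t.g) then some u else none)

/-- the abstraction operator `α : Seq → D` -/
def alpha : List (Tup L) → List (ATup L)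
  | [] => []
  | t :: δ => ⟨t.c, t.k, stableH L (t :: δ) t.g, t.d⟩ :: alpha δ

/-- `instore(σ)` -/
def instoreA (σ : List (ATup L)) : L.B :=
  match σ.head? with
  | some t => t.c
  | none => L.tt

/-- `store(σ)` -/
def storeA (σ : List (ATup L)) : L.B :=
  match σ.getLast? with
  | some t => t.d
  | none => L.tt

/-- the last stable multiset `H_n` of an abstract sequence -/
def lastHA (σ : List (ATup L)) : Multiset L.U :=
  match σ.getLast? with
  | some t => t.h
  | none => 0

/-- connected abstract sequences -/
def Connected (σ : List (ATup L)) : Prop :=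
  (∀ t ∈ σ, t.k = 0) ∧
  σ.Chain' (fun t t' => t.d = t'.c) ∧
  (lastHA L σ = 0 ∨ L.eqv (storeA L σ) L.ff)

/-- `V_ass` of an abstract sequence -/
def VassA (σ : List (ATup L)) : Set L.V := {v | ∃ t ∈ σ, v ∈ fvUs L t.k}
/-- `V_stable` of an abstract sequence -/
def VstableA (σ : List (ATup L)) : Set L.V := fvUs L (lastHA L σ)
/-- `V_constr` of an abstract sequence -/
def VconstrA (σ : List (ATup L)) : Set L.V := {v | ∃ t ∈ σ, v ∈ L.fvB t.d \ L.fvB t.c}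
/-- `V_loc` of an abstract sequence for a goal with free variables `fvG` -/
def VlocA (fvG : Set L.V) (σ : List (ATup L)) : Set L.V :=
  (VconstrA L σ ∪ VstableA L σ) \ (VassA L σ ∪ fvG)

/-- the set of assumption atoms of an abstract sequence -/
def AssA (σ : List (ATup L)) : Set L.U := {a | ∃ t ∈ σ, a ∈ t.k}
/-- the set of atoms of the last stable multiset of an abstract sequence -/
def StableA (σ : List (ATup L)) : Set L.U := {a | a ∈ lastHA L σ}
/-- the set of input constraints of an abstract sequence -/
def IncA (σ : List (ATup L)) : Set L.B := {b | ∃ t ∈ σ, t.c = b}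

/-- the compositional semantics `S_P(G) = α(S'_P(G))` -/
def Ssem (P : Program L) (G : Goal L) : Set (List (ATup L)) :=
  {σ | ∃ δ, SP' L P (index0 L G) δ ∧ alpha L δ = σ}

/-! ### The closure operator `η` and the composition operator `∥` -/

/-- the indexed stable multisets `H̃_i` of an abstract sequence -/
def tildeList : ℕ → Multiset (L.U × ℕ) → List (ATup L) → List (Multiset (L.U × ℕ))
  | _, _, [] => []
  | i, prev, t :: rest =>
      (prev + (t.h - prev.map Prod.fst).map (fun u => (u, i))) ::
        tildeList (i + 1) (prev + (t.h - prev.map Prod.fst).map (fun u => (u, i))) rest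

/-- `σ ∖ W`: remove the multiset `W` of indexed atoms from the (indexed)
stable multisets of `σ`, then remove the indexes -/
def seqSub (σ : List (ATup L)) (W : Multiset (L.U × ℕ)) : List (ATup L) :=
  (σ.zip (tildeList L 1 0 σ)).map (fun p => ⟨p.1.c, p.1.k, (p.2 - W).map Prod.fst, p.1.d⟩)

/-- the upper closure operator `η` (as a membership predicate:
`Eta S σ` iff `σ ∈ η(S)`) -/
inductive Eta (S : Set (List (ATup L))) : List (ATup L) → Prop
  | base {σ : List (ATup L)} : σ ∈ S → Eta S σ
  | reduce (σ' σ'' : List (ATup L)) (c : L.B) (k h : Multiset L.U) (d : L.B)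
      (K' : Multiset L.U) (W : Multiset (L.U × ℕ))
      (hmem : Eta S (σ' ++ ⟨c, k, h, d⟩ :: σ''))
      (hK : K' ≤ k)
      (hW : W ≤ (tildeList L 1 0 (σ' ++ (⟨c, k, h, d⟩ : ATup L) :: σ'')).getD σ'.length 0)
      (hrel : Multiset.Rel (fun (a : L.U) (w : L.U × ℕ) => L.eqAtom c a w.1) K' W) :
      Eta S (seqSub L (σ' ++ ⟨c, k - K', h, d⟩ :: σ'') W)

/-- the raw interleaving underlying the composition operator `∥` on sequences -/
inductive Inter : List (ATup L) → List (ATup L) → List (ATup L) → Prop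
  | last (c : L.B) (h1 h2 : Multiset L.U) :
      Inter [⟨c, 0, h1, c⟩] [⟨c, 0, h2, c⟩] [⟨c, 0, h1 + h2, c⟩]
  | left (t : ATup L) (σ₁ : List (ATup L)) (t₂ : ATup L) (σ₂' σ : List (ATup L))
      (hne : σ₁ ≠ [])
      (h : Inter σ₁ (t₂ :: σ₂') σ) :
      Inter (t :: σ₁) (t₂ :: σ₂') (⟨t.c, t.k, t.h + t₂.h, t.d⟩ :: σ)
  | right (t₁ : ATup L) (σ₁' : List (ATup L)) (t : ATup L) (σ₂ σ : List (ATup L))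
      (hne : σ₂ ≠ [])
      (h : Inter (t₁ :: σ₁') σ₂ σ) :
      Inter (t₁ :: σ₁') (t :: σ₂) (⟨t.c, t.k, t₁.h + t.h, t.d⟩ :: σ)

/-- the composition operator `∥` on (pairs of) abstract sequences -/
def ParSeq (σ₁ σ₂ : List (ATup L)) : Set (List (ATup L)) :=
  {σ | Inter L σ₁ σ₂ σ ∧ InD L σ}

/-- `σ₁ ∥ σ₂` is defined (for sequences of goals with free variables `fv₁`, `fv₂`) -/
def ParDefinedV (fv₁ fv₂ : Set L.V) (σ₁ σ₂ : List (ATup L)) : Prop :=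
  (VlocA L fv₁ σ₁ ∪ fv₁) ∩ (VlocA L fv₂ σ₂ ∪ fv₂) = fv₁ ∩ fv₂

/-- the composition operator `∥` on sets of abstract sequences (for goals with
free variables `fv₁`, `fv₂`) -/
def ParSet (fv₁ fv₂ : Set L.V) (S₁ S₂ : Set (List (ATup L))) : Set (List (ATup L)) :=
  {σ | ∃ σ₁ ∈ S₁, ∃ σ₂ ∈ S₂,
    ParDefinedV L fv₁ fv₂ σ₁ σ₂ ∧
    Eta L (ParSeq L σ₁ σ₂) σ ∧
    (VlocA L fv₁ σ₁ ∪ VlocA L fv₂ σ₂) ∩ VassA L σ = ∅ ∧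
    ∀ i (h : i < σ.length),
      (VlocA L fv₁ σ₁ ∪ VlocA L fv₂ σ₂) ∩ L.fvB (σ.get ⟨i, h⟩).c ⊆
        {v | ∃ t ∈ σ.take i, v ∈ L.fvB t.d} ∪ fvUs L (σ.get ⟨i, h⟩).h}

/-! ### The standard transition system and the data sufficient answers -/

/-- a configuration `⟨G,K,d⟩` of the standard transition system -/
structure Conf (L : Lang) where
  goal : Goal L
  chr : Multiset L.U
  store : L.B

/-- the standard transition relation (rules **Solve**, **Introduce**, **Simplify**) -/
inductive StdStep (P : Program L) : Conf L → Conf L → Prop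
  | solve (c : L.B) (G : Goal L) (K : Multiset L.U) (d d' : L.B)
      (h : L.eqv (L.and c d) d') (hfv : L.fvB d' ⊆ L.fvB c ∪ L.fvB d) :
      StdStep P ⟨Sum.inl c ::ₘ G, K, d⟩ ⟨G, K, d'⟩
  | introduce (u : L.U) (G : Goal L) (K : Multiset L.U) (d : L.B) :
      StdStep P ⟨Sum.inr u ::ₘ G, K, d⟩ ⟨G, u ::ₘ K, d⟩
  | simplify (r : Rule L) (hr : r ∈ P.1) (H' : Multiset L.U) (G : Goal L)
      (K : Multiset L.U) (d : L.B)
      (hcard : H'.card = r.head.card)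
      (hg : L.entails d (L.exQ (fvUs L r.head) (L.and (L.eqC r.head H') r.guard))) :
      StdStep P ⟨G, H' + K, d⟩ ⟨r.body + G, K, L.and (L.eqC r.head H') d⟩

/-- the data sufficient answers `SA_P(G)` of the standard semantics -/
def SA (P : Program L) (G : Goal L) : Set L.B :=
  {b | ∃ d, Relation.ReflTransGen (StdStep L P) ⟨G, 0, L.tt⟩ ⟨0, 0, d⟩ ∧
        (¬ ∃ s', StdStep L P ⟨0, 0, d⟩ s') ∧ b = L.exNot (fvGoal0 L G) d} ∪
  {b | (∃ G' K d, Relation.ReflTransGen (StdStep L P) ⟨G, 0, L.tt⟩ ⟨G', K, d⟩ ∧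
        L.eqv d L.ff) ∧ b = L.ff}

/-- the data sufficient answers `SA'_P(G)` computed by the compositional
transition system with empty assumptions -/
def SA' (P : Program L) (G : Goal L) : Set L.B :=
  {b | ∃ c, Relation.ReflTransGen
        (fun s s' : IGoal L × L.B => Step L P s.1 s.2 0 s'.1 s'.2)
        (index0 L G, L.tt) (0, c) ∧
      (¬ ∃ K g' d, Step L P 0 c K g' d) ∧ b = L.exNot (fvGoal0 L G) c}

/-! ### Auxiliary operations on concrete sequences -/

/-- `δ ⊕ W`: add the (indexed) goal `W` to every goal component of `δ` -/
def oplus (δ : List (Tup L)) (W : IGoal L) : List (Tup L) :=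
  δ.map (fun t => ⟨t.g + W, t.c, t.k, t.g' + W, t.d⟩)

/-- `δ ⊖ W`: remove the (indexed) goal `W` from every goal component of `δ` -/
def ominus (δ : List (Tup L)) (W : IGoal L) : List (Tup L) :=
  δ.map (fun t => ⟨t.g - W, t.c, t.k, t.g' - W, t.d⟩)

/-- the operator `Φ` on interpretations -/
def Phi (P : Program L) (I : IGoal L → Set (List (Tup L))) :
    IGoal L → Set (List (Tup L)) := fun g =>
  {δ | ∃ t rest, δ = t :: rest ∧ t.g = g ∧ ¬ L.eqv t.c L.ff ∧
        Step L P t.g t.c t.k t.g' t.d ∧ rest ∈ I t.g' ∧ Compatible L t rest ∧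
        IsSeq L P δ} ∪
  {δ | ∃ c : L.B, δ = [⟨g, c, 0, g, c⟩]}

/-! ### Adding a goal -/

theorem maxIdx_le_iff (L : Lang) (g : IGoal L) (n : ℕ) :
    maxIdx L g ≤ n ↔ ∀ a ∈ g, a.2 ≤ n := by
  have foldr_max_le_iff : ∀ l : List ℕ, l.foldr max 0 ≤ n ↔ ∀ m ∈ l, m ≤ n := by
    intro l
    induction l with
    | nil => simp
    | cons m l ih => simp [ih]
  simp only [maxIdx, foldr_max_le_iff, Multiset.mem_toList, Multiset.mem_map,
    forall_exists_index, and_imp, forall_apply_eq_imp_iff₂]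

theorem maxIdx_add_index0 (L : Lang) (g : IGoal L) (W : Goal L) :
    maxIdx L (g + index0 L W) = maxIdx L g := by
  refine eq_of_forall_ge_iff fun n => ?_
  simp only [maxIdx_le_iff, Multiset.mem_add, index0, Multiset.mem_map]
  constructor
  · exact fun h a ha => h a (Or.inl ha)
  · rintro h a (ha | ⟨b, -, rfl⟩)
    · exact h a ha
    · exact Nat.zero_le n

theorem fvGoal_add (L : Lang) (g h : IGoal L) :
    fvGoal L (g + h) = fvGoal L g ∪ fvGoal L h := by
  ext v
  simp only [fvGoal, Multiset.mem_add, Set.mem_ofPred_eq, Set.mem_union, or_and_right, exists_or]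

theorem fvGoal_index0 (L : Lang) (W : Goal L) :
    fvGoal L (index0 L W) = fvGoal0 L W := by
  ext v
  simp [fvGoal, fvGoal0, index0]

theorem index0_add (L : Lang) (G W : Goal L) :
    index0 L (G + W) = index0 L G + index0 L W :=
  Multiset.map_add _ G W

theorem Step.add_index0 {L : Lang} {P : Program L} {g g' : IGoal L} {c d : L.B}
    {K : Multiset L.U} (h : Step L P g c K g' d) (W : Goal L) :
    Step L P (g + index0 L W) c K (g' + index0 L W) d := by
  rcases h with ⟨hK, cb, i, G, rfl, rfl, hd, hfv⟩ | ⟨G0, r, hr, A, hG0, hg, hcard, hent, hg', hd⟩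
  · exact Or.inl ⟨hK, cb, i, _, Multiset.cons_add _ _ _, rfl, hd, hfv⟩
  · refine Or.inr ⟨G0, r, hr, A + index0 L W, hG0, ?_, hcard, hent, ?_, hd⟩
    · rw [hg, add_assoc]
    · rw [maxIdx_add_index0, hg', add_assoc]

theorem IsSeq.oplus_index0 {L : Lang} {P : Program L} {δ : List (Tup L)}
    (h : IsSeq L P δ) (W : Goal L) : IsSeq L P (oplus L δ (index0 L W)) := by
  induction h with
  | last g c => exact IsSeq.last _ c
  | step t t' rest hstep hlink hmono _ ih =>
    exact IsSeq.step _ _ _ (hstep.add_index0 W) (congrArg (· + index0 L W) hlink) hmono ih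

theorem vlocT_add_subset (L : Lang) (t : Tup L) (W : IGoal L) :
    VlocT L ⟨t.g + W, t.c, t.k, t.g' + W, t.d⟩ ⊆ VlocT L t := by
  intro v
  simp only [VlocT, fvGoal_add, Set.mem_sdiff, Set.mem_union]
  tauto

theorem vlocC_oplus_subset (L : Lang) (δ : List (Tup L)) (W : IGoal L) :
    VlocC L (oplus L δ W) ⊆ VlocC L δ := by
  rintro v ⟨t, ht, hv⟩
  obtain ⟨s, hs, rfl⟩ := List.mem_map.1 ht
  exact ⟨s, hs, vlocT_add_subset L s W hv⟩

theorem vassC_oplus (L : Lang) (δ : List (Tup L)) (W : IGoal L) :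
    VassC L (oplus L δ W) = VassC L δ := by
  ext v
  simp [VassC, oplus]

theorem vstableC_subset_oplus (L : Lang) (δ : List (Tup L)) (W : IGoal L) :
    VstableC L δ ⊆ VstableC L (oplus L δ W) := by
  rintro v ⟨t, ht, hv⟩
  refine ⟨⟨t.g + W, t.c, t.k, t.g' + W, t.d⟩, by simp [oplus, ht], ?_⟩
  rw [fvGoal_add]
  exact Or.inl hv

theorem Compatible.oplus {L : Lang} {t : Tup L} {δ : List (Tup L)} (h : Compatible L t δ)
    (W : IGoal L) (hW : fvGoal L W ∩ VlocC L δ = ∅) :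
    Compatible L ⟨t.g + W, t.c, t.k, t.g' + W, t.d⟩ (oplus L δ W) := by
  obtain ⟨hhead, hloc, hass, hstore⟩ := h
  refine ⟨?_, ?_, ?_, ?_⟩
  · intro t₂ ht₂
    rw [CHR.oplus, List.head?_map] at ht₂
    obtain ⟨s, hs, rfl⟩ := Option.map_eq_some_iff.1 ht₂
    exact hhead s hs
  · refine Set.eq_empty_of_forall_notMem fun v hv => ?_
    have hvloc := vlocC_oplus_subset L δ W hv.1
    have hvt : v ∉ fvTup L t := fun hv' => Set.notMem_empty v (hloc ▸ ⟨hvloc, hv'⟩)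
    have hvW : v ∉ fvGoal L W := fun hv' => Set.notMem_empty v (hW ▸ ⟨hv', hvloc⟩)
    have hvt' := hv.2
    simp only [fvTup, fvGoal_add, Set.mem_union] at hvt hvt'
    tauto
  · rw [vassC_oplus]
    exact Set.subset_eq_empty (Set.inter_subset_inter_left _ (vlocT_add_subset L t W)) hass
  · rintro i hi v ⟨hv, hvc⟩
    have hi' : i < δ.length := by simpa [CHR.oplus] using hi
    have hvc' : v ∈ L.fvB (δ.get ⟨i, hi'⟩).c := by simpa [CHR.oplus] using hvc
    rcases hstore i hi' ⟨vlocT_add_subset L t W hv, hvc'⟩ with (hd | ⟨s, hs, hvs⟩) | hst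
    · exact Or.inl (Or.inl hd)
    · refine Or.inl (Or.inr ⟨⟨s.g + W, s.c, s.k, s.g' + W, s.d⟩, ?_, hvs⟩)
      rw [CHR.oplus, ← List.map_take]
      exact List.mem_map_of_mem hs
    · exact Or.inr (vstableC_subset_oplus L δ W hst)

theorem SP'.oplus_index0 {L : Lang} {P : Program L} {g : IGoal L} {δ : List (Tup L)}
    (h : SP' L P g δ) (W : Goal L) (hW : fvGoal0 L W ∩ VlocC L δ = ∅) :
    SP' L P (g + index0 L W) (oplus L δ (index0 L W)) := by
  induction h with
  | base g c => exact SP'.base _ c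
  | step t δ hcons hstep _ hcompat hseq ih =>
    have hW' : fvGoal0 L W ∩ VlocC L δ = ∅ := by
      refine Set.subset_eq_empty (Set.inter_subset_inter_right _ ?_) hW
      rintro v ⟨s, hs, hv⟩
      exact ⟨s, List.mem_cons_of_mem t hs, hv⟩
    exact SP'.step ⟨t.g + index0 L W, t.c, t.k, t.g' + index0 L W, t.d⟩ _ hcons
      (hstep.add_index0 W) (ih hW')
      (hcompat.oplus (index0 L W) (by rwa [fvGoal_index0])) (hseq.oplus_index0 W)

/-- **Lemma (adding a goal).** If `δ ∈ S'_P(G)` and `Fv(W) ∩ V_loc(δ) = ∅`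
then `δ ⊕ W ∈ S'_P(G,W)`. -/
theorem adding_goal (L : Lang) (P : Program L) (G W : Goal L)
    (δ : List (Tup L))
    (hδ : SP' L P (index0 L G) δ)
    (hfv : fvGoal0 L W ∩ VlocC L δ = ∅) :
    SP' L P (index0 L (G + W)) (oplus L δ (index0 L W)) := by
  rw [index0_add]
  exact hδ.oplus_index0 W hfv

end CHR
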